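/- Let p and q be money lotteries such that p FOSD q, and let u : ℝ → ℝ be strictly increasing. Then E_p[u] > E_q[u]. Consequently, a choice correspondence compatible with expected-utility maximization with strictly increasing u satisfies the First-Order Stochastic Dominance axiom: C({p,q}) = {p} whenever p FOSD q and {p,q} ∈ M. -/

import Mathlib

/-- A money lottery: a finitely supported probability mass function on ℝ. -/
structure Lottery where
  pmf : ℝ → ℝ
  nonneg : ∀ z, 0 ≤ pmf z
  finSupp : (Function.support pmf).Finite
  total : ∑ᶠ z, pmf z = 1

/-- Expected utility of a lottery `p` under utility function `u`. -/
noncomputable def EU (p : Lottery) (u : ℝ → ℝ) : ℝ := ∑ᶠ z, p.pmf z * u z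

/-- Cumulative distribution function of a lottery. -/
noncomputable def cdf (p : Lottery) (x : ℝ) : ℝ := ∑ᶠ z, if z ≤ x then p.pmf z else 0

/-- `p` first-order stochastically dominates `q`. -/
def FOSD (p q : Lottery) : Prop :=
  (∀ x, cdf p x ≤ cdf q x) ∧ ∃ x, cdf p x < cdf q x

/-- Summation by parts: a weighted sum over `insert a s`, split off at the inserted point `a`. -/
lemma sum_insert_mul_sub (u d : ℝ → ℝ) {s : Finset ℝ} {a : ℝ} (ha : a ∉ s) (m : ℝ) :
    ∑ z ∈ insert a s, d z * (u z - u m) =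
      (∑ z ∈ insert a s, d z) * (u a - u m) + ∑ z ∈ s, d z * (u z - u a) := by
  rw [Finset.sum_insert ha, Finset.sum_insert ha, add_mul, Finset.sum_mul, add_assoc,
    ← Finset.sum_add_distrib]
  congr 1
  exact Finset.sum_congr rfl fun z _ => by ring

/-- If the partial sums of `d` are nonpositive on `s`, `m` bounds `s` from above, and `u` is
strictly increasing, then the `d`-weighted sum of `u z - u m` is nonnegative; it is positive if
some partial sum is negative at a point of `s` below `m`. -/
lemma sum_mul_sub_nonneg_and_pos {u : ℝ → ℝ} (hu : StrictMono u) (d : ℝ → ℝ) (s : Finset ℝ)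
    (hd : ∀ x ∈ s, ∑ z ∈ s with z ≤ x, d z ≤ 0) (m : ℝ) (hm : ∀ z ∈ s, z ≤ m) :
    0 ≤ ∑ z ∈ s, d z * (u z - u m) ∧
      ((∃ x ∈ s, x < m ∧ ∑ z ∈ s with z ≤ x, d z < 0) → 0 < ∑ z ∈ s, d z * (u z - u m)) := by
  induction s using Finset.induction_on_max generalizing m with
  | empty => simp
  | insert a s ha ih =>
    have hfilter : ∀ x ∈ s, {z ∈ insert a s | z ≤ x} = {z ∈ s | z ≤ x} := fun x hx => by
      rw [Finset.filter_insert, if_neg (ha x hx).not_ge]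
    have htop : {z ∈ insert a s | z ≤ a} = insert a s :=
      Finset.filter_true_of_mem fun z hz =>
        (Finset.mem_insert.1 hz).elim le_of_eq fun h => (ha z h).le
    obtain ⟨hs, hs'⟩ := ih (fun x hx => hfilter x hx ▸ hd x (Finset.mem_insert_of_mem hx)) a
      fun z hz => (ha z hz).le
    have hsum := hd a (Finset.mem_insert_self a s)
    rw [htop] at hsum
    have ham : u a - u m ≤ 0 := sub_nonpos.2 (hu.monotone (hm a (Finset.mem_insert_self a s)))
    have hmul := mul_nonneg_of_nonpos_of_nonpos hsum ham
    rw [sum_insert_mul_sub u d (fun h => lt_irrefl a (ha a h))]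
    refine ⟨add_nonneg hmul hs, ?_⟩
    rintro ⟨x, hx, hxm, hneg⟩
    rcases Finset.mem_insert.1 hx with rfl | hxs
    · rw [htop] at hneg
      exact add_pos_of_pos_of_nonneg (mul_pos_of_neg_of_neg hneg (sub_neg.2 (hu hxm))) hs
    · rw [hfilter x hxs] at hneg
      exact add_pos_of_nonneg_of_pos hmul (hs' ⟨x, hxs, ha x hxs, hneg⟩)

namespace Lottery

variable {p : Lottery} {s : Finset ℝ}

lemma sum_pmf_eq_one (hs : Function.support p.pmf ⊆ s) : ∑ z ∈ s, p.pmf z = 1 := by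
  rw [← p.total, finsum_eq_sum_of_support_subset _ hs]

lemma EU_eq_sum (hs : Function.support p.pmf ⊆ s) (u : ℝ → ℝ) :
    EU p u = ∑ z ∈ s, p.pmf z * u z :=
  finsum_eq_sum_of_support_subset _ ((Function.support_mul_subset_left _ _).trans hs)

lemma cdf_eq_sum (hs : Function.support p.pmf ⊆ s) (x : ℝ) :
    cdf p x = ∑ z ∈ s with z ≤ x, p.pmf z := by
  rw [Finset.sum_filter]
  refine finsum_eq_sum_of_support_subset _ (Set.Subset.trans (fun z hz => ?_) hs)
  exact fun h => hz (by simp [h])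

end Lottery

/-- A strictly increasing utility gives a dominating lottery a strictly larger expected utility. -/
lemma FOSD.EU_lt {p q : Lottery} (h : FOSD p q) {u : ℝ → ℝ} (hu : StrictMono u) :
    EU q u < EU p u := by
  obtain ⟨hle, x, hx⟩ := h
  let s : Finset ℝ := insert x (p.finSupp.toFinset ∪ q.finSupp.toFinset)
  have hp : Function.support p.pmf ⊆ s := fun z hz => by simp_all [s]
  have hq : Function.support q.pmf ⊆ s := fun z hz => by simp_all [s]
  have hxs : x ∈ s := Finset.mem_insert_self _ _
  obtain ⟨b, hb⟩ := s.bddAbove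
  have hcdf : ∀ y, ∑ z ∈ s with z ≤ y, (p.pmf z - q.pmf z) = cdf p y - cdf q y := fun y => by
    rw [Finset.sum_sub_distrib, Lottery.cdf_eq_sum hp, Lottery.cdf_eq_sum hq]
  have hpos := (sum_mul_sub_nonneg_and_pos hu (fun z => p.pmf z - q.pmf z) s
    (fun y _ => by linarith [hcdf y, hle y]) (b + 1) fun z hz => by linarith [hb hz]).2
    ⟨x, hxs, by linarith [hb hxs], by linarith [hcdf x]⟩
  have hEU : ∑ z ∈ s, (p.pmf z - q.pmf z) * (u z - u (b + 1)) = EU p u - EU q u := by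
    simp only [sub_mul, mul_sub, Finset.sum_sub_distrib, ← Finset.sum_mul,
      Lottery.sum_pmf_eq_one hp, Lottery.sum_pmf_eq_one hq, Lottery.EU_eq_sum hp,
      Lottery.EU_eq_sum hq]
    ring
  linarith

/-- If `p` FOSD `q` and `u` is strictly increasing then `E_p[u] > E_q[u]`;
consequently any choice correspondence compatible with expected-utility
maximization (with strictly increasing `u`) satisfies the FOSD axiom:
`C({p,q}) = {p}` whenever `p` FOSD `q` and `{p,q} ∈ M`. -/
theorem fosd_eu_and_choice :
    (∀ (p q : Lottery) (u : ℝ → ℝ), StrictMono u → FOSD p q → EU q u < EU p u) ∧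
    (∀ (M : Set (Set Lottery)) (C : Set Lottery → Set Lottery) (u : ℝ → ℝ),
      StrictMono u →
      (∀ A ∈ M, C A = {p ∈ A | ∀ q ∈ A, EU q u ≤ EU p u}) →
      ∀ p q : Lottery, FOSD p q → ({p, q} : Set Lottery) ∈ M →
        C {p, q} = {p}) := by
  refine ⟨fun p q u hu h => h.EU_lt hu, fun M C u hu hC p q h hM => ?_⟩
  have hlt := h.EU_lt hu
  rw [hC _ hM]
  ext r
  simp only [Set.mem_ofPred_eq, Set.mem_insert_iff, Set.mem_singleton_iff, forall_eq_or_imp,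
    forall_eq]
  constructor
  · rintro ⟨rfl | rfl, hr, -⟩
    · rfl
    · exact absurd hlt hr.not_gt
  · rintro rfl
    exact ⟨Or.inl rfl, le_rfl, hlt.le⟩
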